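/- arXiv:2406.02809 — 7 statements merged into one kernel-verified Lean document; each statement's English description precedes it below -/
import Mathlib

section
/- Let u : ℝ² → ℝ be a smooth function of the variables (t,x) that solves the heat equation ∂_t u = ∂_x² u and satisfies u(t,x) ≠ 0 for all (t,x) ∈ ℝ². Then the function v := −2·(∂_x u)/u solves the Burgers equation ∂_t v + v·∂_x v = ∂_x² v (the Hopf–Cole transformation maps nonvanishing solutions of the heat equation to solutions of the Burgers equation). -/
open Function

theorem hasDerivAt_uncurry_fst {g : ℝ → ℝ → ℝ} {t x : ℝ}
    (hg : DifferentiableAt ℝ (uncurry g) (t, x)) :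
    HasDerivAt (fun s => g s x) (fderiv ℝ (uncurry g) (t, x) (1, 0)) t :=
  HasFDerivAt.comp_hasDerivAt (f := fun s => (s, x)) t hg.hasFDerivAt
    ((hasDerivAt_id t).prodMk (hasDerivAt_const t x))

theorem hasDerivAt_uncurry_snd {g : ℝ → ℝ → ℝ} {t x : ℝ}
    (hg : DifferentiableAt ℝ (uncurry g) (t, x)) :
    HasDerivAt (g t) (fderiv ℝ (uncurry g) (t, x) (0, 1)) x :=
  HasFDerivAt.comp_hasDerivAt (f := fun y => (t, y)) x hg.hasFDerivAt
    ((hasDerivAt_const x t).prodMk (hasDerivAt_id x))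

theorem contDiff_uncurry_deriv_snd {g : ℝ → ℝ → ℝ}
    (hg : ContDiff ℝ (⊤ : ℕ∞) (uncurry g)) :
    ContDiff ℝ (⊤ : ℕ∞) (uncurry fun t => deriv (g t)) := by
  have h : (uncurry fun t => deriv (g t)) = fun p => fderiv ℝ (uncurry g) p (0, 1) := by
    ext ⟨t, x⟩
    exact (hasDerivAt_uncurry_snd (hg.differentiable (by simp) _)).deriv
  rw [h]
  exact (hg.fderiv_right (by simp)).clm_apply contDiff_const

theorem deriv_deriv_comm_of_contDiff {g : ℝ → ℝ → ℝ}
    (hg : ContDiff ℝ (⊤ : ℕ∞) (uncurry g)) (t x : ℝ) :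
    deriv (fun s => deriv (g s) x) t = deriv (fun y => deriv (fun s => g s y) t) x := by
  have hd : Differentiable ℝ (uncurry g) := hg.differentiable (by simp)
  have hd' : Differentiable ℝ (fderiv ℝ (uncurry g)) :=
    (hg.fderiv_right (m := (⊤ : ℕ∞)) (by simp)).differentiable (by simp)
  have hF (w : ℝ × ℝ) : HasFDerivAt (uncurry fun s y => fderiv ℝ (uncurry g) (s, y) w)
      ((fderiv ℝ (fderiv ℝ (uncurry g)) (t, x)).flip w) (t, x) := by
    have h := (hd' (t, x)).hasFDerivAt.clm_apply (hasFDerivAt_const w (t, x))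
    rw [ContinuousLinearMap.comp_zero, zero_add] at h
    exact h
  have h₁ : (fun s => deriv (g s) x) = fun s => fderiv ℝ (uncurry g) (s, x) (0, 1) :=
    funext fun s => (hasDerivAt_uncurry_snd (hd _)).deriv
  have h₂ : (fun y => deriv (fun s => g s y) t) = fun y => fderiv ℝ (uncurry g) (t, y) (1, 0) :=
    funext fun y => (hasDerivAt_uncurry_fst (hd _)).deriv
  have hsymm : IsSymmSndFDerivAt ℝ (uncurry g) (t, x) :=
    hg.contDiffAt.isSymmSndFDerivAt (by simpa using WithTop.coe_le_coe.2 (le_top (a := (2 : ℕ∞))))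
  rw [h₁, h₂, (hasDerivAt_uncurry_fst (hF (0, 1)).differentiableAt).deriv,
    (hasDerivAt_uncurry_snd (hF (1, 0)).differentiableAt).deriv, (hF _).fderiv, (hF _).fderiv]
  exact hsymm.eq (1, 0) (0, 1)

/-- **Hopf–Cole transformation.**
If a smooth nonvanishing function `u : ℝ² → ℝ` (coordinates `(t,x)`) solves the heat
equation `∂ₜ u = ∂ₓ² u`, then `v := -2 ∂ₓ u / u` solves the Burgers equation
`∂ₜ v + v ∂ₓ v = ∂ₓ² v`. -/
theorem hopf_cole_heat_to_burgers
    (u : ℝ → ℝ → ℝ)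
    (hu : ContDiff ℝ (⊤ : ℕ∞) (Function.uncurry u))
    (hne : ∀ t x, u t x ≠ 0)
    (hheat : ∀ t x, deriv (fun s => u s x) t = deriv (deriv (u t)) x)
    (v : ℝ → ℝ → ℝ)
    (hv : ∀ t x, v t x = -2 * deriv (u t) x / u t x) :
    ∀ t x, deriv (fun s => v s x) t + v t x * deriv (v t) x
      = deriv (deriv (v t)) x := by
  intro t x
  have hu₁ := contDiff_uncurry_deriv_snd hu
  have hu₂ := contDiff_uncurry_deriv_snd hu₁
  have hasDeriv_snd {g : ℝ → ℝ → ℝ} (hg : ContDiff ℝ (⊤ : ℕ∞) (uncurry g)) (y : ℝ) :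
      HasDerivAt (g t) (deriv (g t) y) y :=
    (hasDerivAt_uncurry_snd (hg.differentiable (by simp) _)).differentiableAt.hasDerivAt
  have hasDeriv_fst {g : ℝ → ℝ → ℝ} (hg : ContDiff ℝ (⊤ : ℕ∞) (uncurry g)) :
      HasDerivAt (fun s => g s x) (deriv (fun s => g s x) t) t :=
    (hasDerivAt_uncurry_fst (hg.differentiable (by simp) _)).differentiableAt.hasDerivAt
  have hut : HasDerivAt (fun s => u s x) (deriv (deriv (u t)) x) t :=
    hheat t x ▸ hasDeriv_fst hu
  have huxt : HasDerivAt (fun s => deriv (u s) x) (deriv (deriv (deriv (u t))) x) t := by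
    have h := hasDeriv_fst hu₁
    rw [deriv_deriv_comm_of_contDiff hu, funext (hheat t)] at h
    exact h
  have hvt := ((huxt.const_mul (-2)).fun_div hut (hne t x)).deriv
  have hvx (y : ℝ) := (((hasDeriv_snd hu₁ y).const_mul (-2)).fun_div (hasDeriv_snd hu y)
    (hne t y)).deriv
  have hvxx := (((((hasDeriv_snd hu₂ x).const_mul (-2)).fun_mul (hasDeriv_snd hu x)).fun_sub
    (((hasDeriv_snd hu₁ x).const_mul (-2)).fun_mul (hasDeriv_snd hu₁ x))).fun_div
    ((hasDeriv_snd hu x).fun_pow 2) (pow_ne_zero 2 (hne t x))).deriv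
  have hv' : v = fun s y => -2 * deriv (u s) y / u s y := funext₂ hv
  subst hv'
  simp only [funext hvx, hvt, hvxx]
  have := hne t x
  field_simp
  ring
end

section
/- Let u : ℝ² → ℝ be a smooth function of the variables (t,x) that solves the heat equation ∂_t u = ∂_x² u. Then for all k, l ∈ ℕ the function G^k P^l u (the operator G applied k times to the operator P applied l times to u) also solves the heat equation. (This is the claim of Theorem 1 that each 𝔔^{kl} = (G^k P^l u)∂_u is a linear generalized symmetry of the heat equation.) -/
/-- The operator `P = ∂ₓ` acting on functions of `(t,x)`. -/
noncomputable def heatP (f : ℝ → ℝ → ℝ) : ℝ → ℝ → ℝ :=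
  fun t x => deriv (f t) x

/-- The operator `G = t ∂ₓ + x/2` acting on functions of `(t,x)`. -/
noncomputable def heatG (f : ℝ → ℝ → ℝ) : ℝ → ℝ → ℝ :=
  fun t x => t * deriv (f t) x + x / 2 * f t x

/-- The `x`-derivative of a function of `(t, x)` as a value of its total derivative. -/
lemma hasDerivAt_snd_fderiv_uncurry {f : ℝ → ℝ → ℝ}
    (hf : Differentiable ℝ (Function.uncurry f)) (t x : ℝ) :
    HasDerivAt (f t) (fderiv ℝ (Function.uncurry f) (t, x) (0, 1)) x :=
  (hf (t, x)).hasFDerivAt.comp_hasDerivAt x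
    ((hasDerivAt_const x t).prodMk (hasDerivAt_id x))

/-- The `t`-derivative of a function of `(t, x)` as a value of its total derivative. -/
lemma hasDerivAt_fst_fderiv_uncurry {f : ℝ → ℝ → ℝ}
    (hf : Differentiable ℝ (Function.uncurry f)) (t x : ℝ) :
    HasDerivAt (fun s => f s x) (fderiv ℝ (Function.uncurry f) (t, x) (1, 0)) t :=
  HasFDerivAt.comp_hasDerivAt (f := fun s => (s, x)) t (hf (t, x)).hasFDerivAt
    ((hasDerivAt_id t).prodMk (hasDerivAt_const t x))

lemma uncurry_heatP {f : ℝ → ℝ → ℝ} (hf : Differentiable ℝ (Function.uncurry f)) :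
    Function.uncurry (heatP f) = fun p => fderiv ℝ (Function.uncurry f) p (0, 1) := by
  funext ⟨t, x⟩
  exact (hasDerivAt_snd_fderiv_uncurry hf t x).deriv

lemma ContDiff.heatP {f : ℝ → ℝ → ℝ} (hf : ContDiff ℝ (⊤ : ℕ∞) (Function.uncurry f)) :
    ContDiff ℝ (⊤ : ℕ∞) (Function.uncurry (heatP f)) := by
  rw [uncurry_heatP (hf.differentiable (by simp))]
  exact (hf.fderiv_right (m := (⊤ : ℕ∞)) (by simp)).clm_apply contDiff_const

lemma ContDiff.heatG {f : ℝ → ℝ → ℝ} (hf : ContDiff ℝ (⊤ : ℕ∞) (Function.uncurry f)) :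
    ContDiff ℝ (⊤ : ℕ∞) (Function.uncurry (heatG f)) :=
  (contDiff_fst.mul hf.heatP).add ((contDiff_snd.div_const 2).mul hf)

/-- Partial derivatives of a smooth function of `(t, x)` commute. -/
lemma deriv_fst_heatP {f : ℝ → ℝ → ℝ} (hf : ContDiff ℝ (⊤ : ℕ∞) (Function.uncurry f))
    (t x : ℝ) :
    deriv (fun s => heatP f s x) t = deriv (fun y => deriv (fun s => f s y) t) x := by
  have hd : Differentiable ℝ (Function.uncurry f) := hf.differentiable (by simp)
  have hd' : DifferentiableAt ℝ (fderiv ℝ (Function.uncurry f)) (t, x) :=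
    (hf.fderiv_right (m := (⊤ : ℕ∞)) (by simp)).differentiable (by simp) _
  have hsymm : IsSymmSndFDerivAt ℝ (Function.uncurry f) (t, x) :=
    hf.contDiffAt.isSymmSndFDerivAt
      (by simpa using WithTop.coe_le_coe.2 (le_top (a := (2 : ℕ∞))))
  have h₁ : HasDerivAt (fun s => heatP f s x)
      (fderiv ℝ (fderiv ℝ (Function.uncurry f)) (t, x) (1, 0) (0, 1)) t := by
    have h : HasDerivAt (fun s => fderiv ℝ (Function.uncurry f) (s, x))
        (fderiv ℝ (fderiv ℝ (Function.uncurry f)) (t, x) (1, 0)) t :=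
      hd'.hasFDerivAt.comp_hasDerivAt t ((hasDerivAt_id t).prodMk (hasDerivAt_const t x))
    have he : (fun s => heatP f s x) = fun s => fderiv ℝ (Function.uncurry f) (s, x) (0, 1) :=
      funext fun s => (hasDerivAt_snd_fderiv_uncurry hd s x).deriv
    rw [he]
    simpa using h.clm_apply (hasDerivAt_const t ((0, 1) : ℝ × ℝ))
  have h₂ : HasDerivAt (fun y => deriv (fun s => f s y) t)
      (fderiv ℝ (fderiv ℝ (Function.uncurry f)) (t, x) (0, 1) (1, 0)) x := by
    have h : HasDerivAt (fun y => fderiv ℝ (Function.uncurry f) (t, y))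
        (fderiv ℝ (fderiv ℝ (Function.uncurry f)) (t, x) (0, 1)) x :=
      hd'.hasFDerivAt.comp_hasDerivAt x ((hasDerivAt_const x t).prodMk (hasDerivAt_id x))
    have he : (fun y => deriv (fun s => f s y) t) =
        fun y => fderiv ℝ (Function.uncurry f) (t, y) (1, 0) :=
      funext fun y => (hasDerivAt_fst_fderiv_uncurry hd t y).deriv
    rw [he]
    simpa using h.clm_apply (hasDerivAt_const x ((1, 0) : ℝ × ℝ))
  rw [h₁.deriv, h₂.deriv, hsymm.eq]

/-- A smooth solution `f` of the heat equation `∂ₜ f = ∂ₓ² f`. -/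
structure IsSmoothHeatSolution (f : ℝ → ℝ → ℝ) : Prop where
  contDiff : ContDiff ℝ (⊤ : ℕ∞) (Function.uncurry f)
  deriv_fst : ∀ t x, deriv (fun s => f s x) t = deriv (deriv (f t)) x

namespace IsSmoothHeatSolution

lemma heatP {f : ℝ → ℝ → ℝ} (hf : IsSmoothHeatSolution f) :
    IsSmoothHeatSolution (heatP f) where
  contDiff := hf.contDiff.heatP
  deriv_fst t x := by
    rw [deriv_fst_heatP hf.contDiff, funext (hf.deriv_fst t)]
    rfl

lemma heatG {f : ℝ → ℝ → ℝ} (hf : IsSmoothHeatSolution f) :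
    IsSmoothHeatSolution (heatG f) where
  contDiff := hf.contDiff.heatG
  deriv_fst t x := by
    have differentiable {g : ℝ → ℝ → ℝ} (hg : ContDiff ℝ (⊤ : ℕ∞) (Function.uncurry g)) :
        Differentiable ℝ (Function.uncurry g) := hg.differentiable (by simp)
    have hx {g : ℝ → ℝ → ℝ} (hg : ContDiff ℝ (⊤ : ℕ∞) (Function.uncurry g)) (y : ℝ) :
        HasDerivAt (g t) (deriv (g t) y) y :=
      (hasDerivAt_snd_fderiv_uncurry (differentiable hg) t y).differentiableAt.hasDerivAt
    have ht {g : ℝ → ℝ → ℝ} (hg : IsSmoothHeatSolution g) :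
        HasDerivAt (fun s => g s x) (deriv (deriv (g t)) x) t := by
      rw [← hg.deriv_fst]
      exact (hasDerivAt_fst_fderiv_uncurry
        (differentiable hg.contDiff) t x).differentiableAt.hasDerivAt
    have hGt : HasDerivAt (fun s => _root_.heatG f s x)
        (1 * _root_.heatP f t x + t * deriv (deriv (_root_.heatP f t)) x +
          x / 2 * deriv (deriv (f t)) x) t :=
      ((hasDerivAt_id t).mul (ht hf.heatP)).add ((ht hf).const_mul (x / 2))
    have hGx : deriv (_root_.heatG f t) = fun y =>
        t * deriv (_root_.heatP f t) y + (1 / 2 * f t y + y / 2 * _root_.heatP f t y) :=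
      funext fun y => HasDerivAt.deriv <|
        ((hx hf.contDiff.heatP y).const_mul t).add
          (((hasDerivAt_id y).div_const 2).mul (hx hf.contDiff y))
    have hGxx : HasDerivAt (fun y =>
        t * deriv (_root_.heatP f t) y + (1 / 2 * f t y + y / 2 * _root_.heatP f t y))
        (t * deriv (deriv (_root_.heatP f t)) x + (1 / 2 * _root_.heatP f t x +
          (1 / 2 * _root_.heatP f t x + x / 2 * deriv (deriv (f t)) x))) x :=
      ((hx hf.contDiff.heatP.heatP x).const_mul t).add
        (((hx hf.contDiff x).const_mul (1 / 2)).add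
          (((hasDerivAt_id x).div_const 2).mul (hx hf.contDiff.heatP x)))
    rw [hGt.deriv, hGx, hGxx.deriv]
    ring

end IsSmoothHeatSolution

/-- If a smooth function `u : ℝ² → ℝ` solves the heat equation `∂ₜ u = ∂ₓ² u`, then for
all `k, l ∈ ℕ` the function `G^k P^l u` also solves the heat equation; i.e., each
`𝔔^{kl} = (G^k P^l u) ∂_u` is a linear generalized symmetry of the heat equation. -/
theorem heat_generalized_symmetries
    (u : ℝ → ℝ → ℝ)
    (hu : ContDiff ℝ (⊤ : ℕ∞) (Function.uncurry u))
    (hheat : ∀ t x, deriv (fun s => u s x) t = deriv (deriv (u t)) x) :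
    ∀ k l : ℕ, ∀ t x,
      deriv (fun s => (heatG^[k] (heatP^[l] u)) s x) t
        = deriv (deriv ((heatG^[k] (heatP^[l] u)) t)) x := by
  intro k l
  have hP : IsSmoothHeatSolution (heatP^[l] u) :=
    Function.Iterate.rec IsSmoothHeatSolution ⟨hu, hheat⟩ (fun _ h => h.heatP) l
  have hG : IsSmoothHeatSolution (heatG^[k] (heatP^[l] u)) :=
    Function.Iterate.rec IsSmoothHeatSolution hP (fun _ h => h.heatG) k
  exact hG.deriv_fst
end

section
/- Let w : ℝ² → ℝ be a smooth function of the variables (t,x) that solves the potential Burgers equation ∂_t w = ∂_x² w + (∂_x w)², and let h : ℝ² → ℝ be a smooth function that solves the heat equation ∂_t h = ∂_x² h. Then the function η := h·e^{−w} satisfies the linearized potential Burgers equation ∂_t η = ∂_x² η + 2·(∂_x w)·(∂_x η). (This is the claim of Theorem 2 that each 𝔷̃(h) = h e^{−w}∂_w is a generalized symmetry of the potential Burgers equation.) -/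
/-- The derivative of `f e^{-g}`. -/
theorem HasDerivAt.mul_exp_neg {f g : ℝ → ℝ} {f' g' x : ℝ} (hf : HasDerivAt f f' x)
    (hg : HasDerivAt g g' x) :
    HasDerivAt (fun y => f y * Real.exp (-(g y))) ((f' - f x * g') * Real.exp (-(g x))) x := by
  refine (hf.mul hg.fun_neg.exp).congr_deriv ?_
  ring

/-- Each partial function in the second variable of a smooth function is smooth. -/
theorem ContDiff.uncurry_right {u : ℝ → ℝ → ℝ} {n : WithTop ℕ∞}
    (hu : ContDiff ℝ n (Function.uncurry u)) (t : ℝ) : ContDiff ℝ n (u t) :=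
  hu.comp (contDiff_const.prodMk contDiff_id : ContDiff ℝ n fun x : ℝ => (t, x))

/-- Each partial function in the first variable of a smooth function is smooth. -/
theorem ContDiff.uncurry_left {u : ℝ → ℝ → ℝ} {n : WithTop ℕ∞}
    (hu : ContDiff ℝ n (Function.uncurry u)) (x : ℝ) : ContDiff ℝ n fun t => u t x :=
  hu.comp (contDiff_id.prodMk contDiff_const : ContDiff ℝ n fun t : ℝ => (t, x))

/-- A smooth function has its derivative as a derivative at every point. -/
theorem ContDiff.hasDerivAt_deriv {f : ℝ → ℝ} (hf : ContDiff ℝ (⊤ : ℕ∞) f) (x : ℝ) :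
    HasDerivAt f (deriv f x) x :=
  (hf.differentiable (by simp) x).hasDerivAt

/-- The derivative of a smooth function is smooth. -/
theorem ContDiff.deriv_smooth {f : ℝ → ℝ} (hf : ContDiff ℝ (⊤ : ℕ∞) f) :
    ContDiff ℝ (⊤ : ℕ∞) (deriv f) :=
  (contDiff_infty_iff_deriv.1 hf).2

/-- If a smooth `w : ℝ² → ℝ` solves the potential Burgers equation
`∂ₜ w = ∂ₓ² w + (∂ₓ w)²` and a smooth `h : ℝ² → ℝ` solves the heat equation
`∂ₜ h = ∂ₓ² h`, then `η := h e^{−w}` satisfies the linearized potential Burgers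
equation `∂ₜ η = ∂ₓ² η + 2 (∂ₓ w)(∂ₓ η)`; i.e., each `𝔷̃(h) = h e^{−w} ∂_w` is a
generalized symmetry of the potential Burgers equation. -/
theorem potential_burgers_trivial_symmetries
    (w : ℝ → ℝ → ℝ)
    (hw : ContDiff ℝ (⊤ : ℕ∞) (Function.uncurry w))
    (hpb : ∀ t x, deriv (fun s => w s x) t
        = deriv (deriv (w t)) x + (deriv (w t) x) ^ 2)
    (h : ℝ → ℝ → ℝ)
    (hh : ContDiff ℝ (⊤ : ℕ∞) (Function.uncurry h))
    (hheat : ∀ t x, deriv (fun s => h s x) t = deriv (deriv (h t)) x)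
    (η : ℝ → ℝ → ℝ)
    (hη : ∀ t x, η t x = h t x * Real.exp (-(w t x))) :
    ∀ t x, deriv (fun s => η s x) t
      = deriv (deriv (η t)) x + 2 * deriv (w t) x * deriv (η t) x := by
  intro t x
  obtain rfl : η = fun t x => h t x * Real.exp (-(w t x)) := funext₂ hη
  have hwx := hw.uncurry_right t
  have hhx := hh.uncurry_right t
  have eta_x : deriv (fun y => h t y * Real.exp (-(w t y))) =
      fun y => (deriv (h t) y - h t y * deriv (w t) y) * Real.exp (-(w t y)) :=
    funext fun y => ((hhx.hasDerivAt_deriv y).mul_exp_neg (hwx.hasDerivAt_deriv y)).deriv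
  have eta_xx := (((hhx.deriv_smooth.hasDerivAt_deriv x).sub
    ((hhx.hasDerivAt_deriv x).mul (hwx.deriv_smooth.hasDerivAt_deriv x))).mul_exp_neg
      (hwx.hasDerivAt_deriv x)).deriv
  have eta_t := (((hh.uncurry_left x).hasDerivAt_deriv t).mul_exp_neg
    ((hw.uncurry_left x).hasDerivAt_deriv t)).deriv
  simp only [Pi.sub_apply, Pi.mul_apply] at eta_xx
  rw [eta_t, eta_x, eta_xx, hpb, hheat]
  ring
end

section
/- Let v : ℝ² → ℝ be a smooth function of the variables (t,x) that solves the Burgers equation ∂_t v + v·∂_x v = ∂_x² v. Then for all k, l ∈ ℕ the function Ĝ^k P̂^l 1 (the operators applied to the constant function 1) satisfies M_v(Ĝ^k P̂^l 1) = 0, where M_v f = ∂_t f + v·∂_x f − ∂_x² f. In particular, each function ζ^k := P̂^{k+1} 1 satisfies ∂_t ζ^k + v·∂_x ζ^k − ∂_x² ζ^k = 0. -/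
/-- The operator `P̂ = ∂ₓ − v/2` associated with `v`. -/
noncomputable def burgP (v f : ℝ → ℝ → ℝ) : ℝ → ℝ → ℝ :=
  fun t x => deriv (f t) x - (1 / 2) * v t x * f t x

/-- The operator `Ĝ = t P̂ + x/2` associated with `v`. -/
noncomputable def burgG (v f : ℝ → ℝ → ℝ) : ℝ → ℝ → ℝ :=
  fun t x => t * burgP v f t x + x / 2 * f t x

/-- The operator `M_v = ∂ₜ + v ∂ₓ − ∂ₓ²` associated with `v`. -/
noncomputable def burgM (v f : ℝ → ℝ → ℝ) : ℝ → ℝ → ℝ :=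
  fun t x => deriv (fun s => f s x) t + v t x * deriv (f t) x - deriv (deriv (f t)) x

/-- Smoothness of a function of two real variables. -/
def Smooth₂ (f : ℝ → ℝ → ℝ) : Prop := ContDiff ℝ (⊤ : ℕ∞) (Function.uncurry f)

/-- The partial derivative in the first variable. -/
noncomputable def partialT (f : ℝ → ℝ → ℝ) : ℝ → ℝ → ℝ := fun t x => deriv (fun s => f s x) t

/-- The partial derivative in the second variable. -/
noncomputable def partialX (f : ℝ → ℝ → ℝ) : ℝ → ℝ → ℝ := fun t x => deriv (f t) x

namespace Smooth₂

variable {f v : ℝ → ℝ → ℝ}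

lemma hasFDerivAt (hf : Smooth₂ f) (p : ℝ × ℝ) :
    HasFDerivAt (Function.uncurry f) (fderiv ℝ (Function.uncurry f) p) p :=
  (ContDiff.differentiable hf (by simp) p).hasFDerivAt

lemma hasDerivAt_fst (hf : Smooth₂ f) (t x : ℝ) :
    HasDerivAt (fun s => f s x) (fderiv ℝ (Function.uncurry f) (t, x) (1, 0)) t :=
  HasFDerivAt.comp_hasDerivAt (f := fun s => (s, x)) t (hf.hasFDerivAt (t, x))
    ((hasDerivAt_id t).prodMk (hasDerivAt_const t x))

lemma hasDerivAt_snd (hf : Smooth₂ f) (t x : ℝ) :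
    HasDerivAt (f t) (fderiv ℝ (Function.uncurry f) (t, x) (0, 1)) x :=
  HasFDerivAt.comp_hasDerivAt (f := fun y => (t, y)) x (hf.hasFDerivAt (t, x))
    ((hasDerivAt_const x t).prodMk (hasDerivAt_id x))

lemma partialT_eq (hf : Smooth₂ f) (t x : ℝ) :
    partialT f t x = fderiv ℝ (Function.uncurry f) (t, x) (1, 0) :=
  (hf.hasDerivAt_fst t x).deriv

lemma partialX_eq (hf : Smooth₂ f) (t x : ℝ) :
    partialX f t x = fderiv ℝ (Function.uncurry f) (t, x) (0, 1) :=
  (hf.hasDerivAt_snd t x).deriv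

lemma hasDerivAt_partialT (hf : Smooth₂ f) (t x : ℝ) :
    HasDerivAt (fun s => f s x) (partialT f t x) t :=
  (hf.hasDerivAt_fst t x).differentiableAt.hasDerivAt

lemma hasDerivAt_partialX (hf : Smooth₂ f) (t x : ℝ) :
    HasDerivAt (f t) (partialX f t x) x :=
  (hf.hasDerivAt_snd t x).differentiableAt.hasDerivAt

lemma contDiff_fderiv (hf : Smooth₂ f) :
    ContDiff ℝ (⊤ : ℕ∞) (fderiv ℝ (Function.uncurry f)) :=
  ContDiff.fderiv_right hf (by simp)

lemma partialX (hf : Smooth₂ f) : Smooth₂ (partialX f) := by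
  have h : Function.uncurry (_root_.partialX f)
      = fun p => fderiv ℝ (Function.uncurry f) p (0, 1) := by
    ext ⟨t, x⟩
    exact hf.partialX_eq t x
  rw [Smooth₂, h]
  exact hf.contDiff_fderiv.clm_apply contDiff_const

lemma partialT_partialX (hf : Smooth₂ f) (t x : ℝ) :
    partialT (_root_.partialX f) t x = _root_.partialX (partialT f) t x := by
  have hd : HasFDerivAt (fderiv ℝ (Function.uncurry f))
      (fderiv ℝ (fderiv ℝ (Function.uncurry f)) (t, x)) (t, x) :=
    (hf.contDiff_fderiv.differentiable (by simp) (t, x)).hasFDerivAt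
  have h₁ : HasDerivAt (fun s => _root_.partialX f s x)
      (fderiv ℝ (fderiv ℝ (Function.uncurry f)) (t, x) (1, 0) (0, 1)) t := by
    simp only [hf.partialX_eq]
    have := hd.comp_hasDerivAt t ((hasDerivAt_id t).prodMk (hasDerivAt_const t x))
    simpa using this.clm_apply (hasDerivAt_const t ((0, 1) : ℝ × ℝ))
  have h₂ : HasDerivAt (partialT f t)
      (fderiv ℝ (fderiv ℝ (Function.uncurry f)) (t, x) (0, 1) (1, 0)) x := by
    rw [show partialT f t = fun y => fderiv ℝ (Function.uncurry f) (t, y) (1, 0) from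
      funext (hf.partialT_eq t)]
    have := hd.comp_hasDerivAt x ((hasDerivAt_const x t).prodMk (hasDerivAt_id x))
    simpa using this.clm_apply (hasDerivAt_const x ((1, 0) : ℝ × ℝ))
  have hsymm : IsSymmSndFDerivAt ℝ (Function.uncurry f) (t, x) :=
    (ContDiff.contDiffAt hf).isSymmSndFDerivAt
      (by simpa using WithTop.coe_le_coe.2 (le_top : (2 : ℕ∞) ≤ ⊤))
  exact h₁.deriv.trans ((hsymm _ _).trans h₂.deriv.symm)

lemma burgP (hv : Smooth₂ v) (hf : Smooth₂ f) : Smooth₂ (burgP v f) :=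
  ContDiff.sub hf.partialX (ContDiff.mul (ContDiff.mul contDiff_const hv) hf)

lemma burgG (hv : Smooth₂ v) (hf : Smooth₂ f) : Smooth₂ (burgG v f) :=
  ContDiff.add (ContDiff.mul contDiff_fst (hv.burgP hf))
    (ContDiff.mul (contDiff_snd.div_const 2) hf)

end Smooth₂

section

variable {v f : ℝ → ℝ → ℝ}

lemma burgM_eq (v f : ℝ → ℝ → ℝ) (t x : ℝ) :
    burgM v f t x = partialT f t x + v t x * partialX f t x - partialX (partialX f) t x :=
  rfl

/-- `P̂` preserves the smooth kernel of `M_v` when `v` solves the Burgers equation. -/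
lemma burgM_burgP_eq_zero (hv : Smooth₂ v)
    (hburg : ∀ t x, partialT v t x + v t x * partialX v t x = partialX (partialX v) t x)
    (hf : Smooth₂ f) (hM : ∀ t x, burgM v f t x = 0) (t x : ℝ) :
    burgM v (burgP v f) t x = 0 := by
  have hT : partialT (burgP v f) t x = partialT (partialX f) t x
      - (1 / 2 * partialT v t x * f t x + 1 / 2 * v t x * partialT f t x) :=
    ((hf.partialX.hasDerivAt_partialT t x).sub
      (((hv.hasDerivAt_partialT t x).const_mul (1 / 2)).mul (hf.hasDerivAt_partialT t x))).deriv
  have hX : ∀ y, partialX (burgP v f) t y = partialX (partialX f) t y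
      - (1 / 2 * partialX v t y * f t y + 1 / 2 * v t y * partialX f t y) := fun y =>
    ((hf.partialX.hasDerivAt_partialX t y).sub
      (((hv.hasDerivAt_partialX t y).const_mul (1 / 2)).mul (hf.hasDerivAt_partialX t y))).deriv
  have hXX : partialX (partialX (burgP v f)) t x = partialX (partialX (partialX f)) t x
      - ((1 / 2 * partialX (partialX v) t x * f t x + 1 / 2 * partialX v t x * partialX f t x)
        + (1 / 2 * partialX v t x * partialX f t x
          + 1 / 2 * v t x * partialX (partialX f) t x)) := by
    rw [partialX, funext hX]
    exact ((hf.partialX.partialX.hasDerivAt_partialX t x).sub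
      ((((hv.partialX.hasDerivAt_partialX t x).const_mul (1 / 2)).mul
        (hf.hasDerivAt_partialX t x)).add
      (((hv.hasDerivAt_partialX t x).const_mul (1 / 2)).mul
        (hf.partialX.hasDerivAt_partialX t x)))).deriv
  have hft : ∀ y, partialT f t y = partialX (partialX f) t y - v t y * partialX f t y := by
    intro y
    have := hM t y
    rw [burgM_eq] at this
    linarith
  have hfxt : partialT (partialX f) t x = partialX (partialX (partialX f)) t x
      - (partialX v t x * partialX f t x + v t x * partialX (partialX f) t x) := by
    rw [hf.partialT_partialX, partialX, funext hft]
    exact ((hf.partialX.partialX.hasDerivAt_partialX t x).sub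
      ((hv.hasDerivAt_partialX t x).mul (hf.partialX.hasDerivAt_partialX t x))).deriv
  rw [burgM_eq, hT, hX, hXX, hfxt, hft]
  linear_combination (-1 / 2 * f t x) * hburg t x

/-- `Ĝ` maps `f` into the kernel of `M_v` when `f` and `P̂ f` both lie in that kernel. -/
lemma burgM_burgG_eq_zero (hf : Smooth₂ f) (hp : Smooth₂ (burgP v f))
    (hM : ∀ t x, burgM v f t x = 0) (hMP : ∀ t x, burgM v (burgP v f) t x = 0) (t x : ℝ) :
    burgM v (burgG v f) t x = 0 := by
  have hT : partialT (burgG v f) t x = (1 * burgP v f t x + t * partialT (burgP v f) t x)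
      + x / 2 * partialT f t x :=
    (((hasDerivAt_id t).mul (hp.hasDerivAt_partialT t x)).add
      ((hf.hasDerivAt_partialT t x).const_mul (x / 2))).deriv
  have hX : ∀ y, partialX (burgG v f) t y = t * partialX (burgP v f) t y
      + (1 / 2 * f t y + y / 2 * partialX f t y) := fun y =>
    (((hp.hasDerivAt_partialX t y).const_mul t).add
      (((hasDerivAt_id y).div_const 2).mul (hf.hasDerivAt_partialX t y))).deriv
  have hXX : partialX (partialX (burgG v f)) t x = t * partialX (partialX (burgP v f)) t x
      + (1 / 2 * partialX f t x
        + (1 / 2 * partialX f t x + x / 2 * partialX (partialX f) t x)) := by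
    rw [partialX, funext hX]
    exact (((hp.partialX.hasDerivAt_partialX t x).const_mul t).add
      (((hf.hasDerivAt_partialX t x).const_mul (1 / 2)).add
      (((hasDerivAt_id x).div_const 2).mul (hf.partialX.hasDerivAt_partialX t x)))).deriv
  have hP : burgP v f t x = partialX f t x - 1 / 2 * v t x * f t x := rfl
  have h₁ := hM t x
  have h₂ := hMP t x
  rw [burgM_eq] at h₁ h₂ ⊢
  rw [hT, hX, hXX]
  linear_combination hP + t * h₂ + x / 2 * h₁

end

/-- If a smooth `v : ℝ² → ℝ` solves the Burgers equation `∂ₜ v + v ∂ₓ v = ∂ₓ² v`, then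
for all `k, l ∈ ℕ` one has `M_v(Ĝ^k P̂^l 1) = 0`; in particular each
`ζ^k := P̂^{k+1} 1` satisfies `∂ₜ ζ^k + v ∂ₓ ζ^k − ∂ₓ² ζ^k = 0`. -/
theorem burgers_M_annihilates_GkPl_one
    (v : ℝ → ℝ → ℝ)
    (hv : ContDiff ℝ (⊤ : ℕ∞) (Function.uncurry v))
    (hburg : ∀ t x, deriv (fun s => v s x) t + v t x * deriv (v t) x
        = deriv (deriv (v t)) x) :
    (∀ k l : ℕ, ∀ t x,
        burgM v ((burgG v)^[k] ((burgP v)^[l] (fun _ _ => (1 : ℝ)))) t x = 0)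
      ∧ (∀ k : ℕ, ∀ t x,
        burgM v ((burgP v)^[k + 1] (fun _ _ => (1 : ℝ))) t x = 0) := by
  have hP : ∀ l : ℕ, Smooth₂ ((burgP v)^[l] (fun _ _ => (1 : ℝ))) ∧
      ∀ t x, burgM v ((burgP v)^[l] (fun _ _ => (1 : ℝ))) t x = 0 := by
    intro l
    induction l with
    | zero => exact ⟨contDiff_const, fun t x => by simp [burgM]⟩
    | succ l ih =>
      rw [Function.iterate_succ_apply']
      exact ⟨Smooth₂.burgP hv ih.1, burgM_burgP_eq_zero hv hburg ih.1 ih.2⟩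
  have hG : ∀ k l : ℕ,
      Smooth₂ ((burgG v)^[k] ((burgP v)^[l] (fun _ _ => (1 : ℝ)))) ∧
      ∀ t x, burgM v ((burgG v)^[k] ((burgP v)^[l] (fun _ _ => (1 : ℝ)))) t x = 0 := by
    intro k l
    induction k with
    | zero => exact hP l
    | succ k ih =>
      rw [Function.iterate_succ_apply']
      exact ⟨Smooth₂.burgG hv ih.1, burgM_burgG_eq_zero ih.1 (Smooth₂.burgP hv ih.1) ih.2
        (burgM_burgP_eq_zero hv hburg ih.1 ih.2)⟩
  exact ⟨fun k l => (hG k l).2, fun k => (hP (k + 1)).2⟩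
end

section
/- Let v : ℝ² → ℝ be a smooth function of the variables (t,x) that solves the Burgers equation ∂_t v + v·∂_x v = ∂_x² v. Then for all k, l ∈ ℕ the function η^{kl} := ∂_x(Ĝ^k P̂^l 1) satisfies the linearized Burgers equation ∂_t η + v·∂_x η + (∂_x v)·η − ∂_x² η = 0. (This is the claim of Theorem 3 that each 𝔔̂^{kl} = (D_x Ĝ^k P̂^l 1)∂_v is a generalized symmetry of the Burgers equation.) -/
section PartialDerivatives

variable {E : Type*} [NormedAddCommGroup E] [NormedSpace ℝ E]

theorem HasFDerivAt.hasDerivAt_prodMk_left {F : ℝ × ℝ → E} {F' : ℝ × ℝ →L[ℝ] E} {t x : ℝ}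
    (hF : HasFDerivAt F F' (t, x)) : HasDerivAt (fun s => F (s, x)) (F' (1, 0)) t :=
  HasFDerivAt.comp_hasDerivAt (f := fun s : ℝ => (s, x)) t hF
    ((hasDerivAt_id t).prodMk (hasDerivAt_const t x))

theorem HasFDerivAt.hasDerivAt_prodMk_right {F : ℝ × ℝ → E} {F' : ℝ × ℝ →L[ℝ] E} {t x : ℝ}
    (hF : HasFDerivAt F F' (t, x)) : HasDerivAt (fun y => F (t, y)) (F' (0, 1)) x :=
  HasFDerivAt.comp_hasDerivAt (f := fun y : ℝ => (t, y)) x hF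
    ((hasDerivAt_const x t).prodMk (hasDerivAt_id x))

end PartialDerivatives

open Function in
theorem hasDerivAt_snd_of_contDiff {f : ℝ → ℝ → ℝ} (hf : ContDiff ℝ (⊤ : ℕ∞) (uncurry f))
    (t x : ℝ) : HasDerivAt (f t) (fderiv ℝ (uncurry f) (t, x) (0, 1)) x :=
  ((hf.differentiable (by simp)) (t, x)).hasFDerivAt.hasDerivAt_prodMk_right

open Function in
theorem hasDerivAt_fst_of_contDiff {f : ℝ → ℝ → ℝ} (hf : ContDiff ℝ (⊤ : ℕ∞) (uncurry f))
    (t x : ℝ) : HasDerivAt (fun s => f s x) (fderiv ℝ (uncurry f) (t, x) (1, 0)) t :=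
  ((hf.differentiable (by simp)) (t, x)).hasFDerivAt.hasDerivAt_prodMk_left

open Function in
theorem contDiff_deriv_snd {f : ℝ → ℝ → ℝ} (hf : ContDiff ℝ (⊤ : ℕ∞) (uncurry f)) :
    ContDiff ℝ (⊤ : ℕ∞) (uncurry fun t x => deriv (f t) x) := by
  have h : (uncurry fun t x => deriv (f t) x)
      = fun p => fderiv ℝ (uncurry f) p ((0 : ℝ), (1 : ℝ)) := by
    ext ⟨t, x⟩
    exact (hasDerivAt_snd_of_contDiff hf t x).deriv
  rw [h]
  exact (hf.fderiv_right (by simp)).clm_apply contDiff_const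

/-- Equality of mixed partial derivatives for smooth functions on the plane. -/
theorem deriv_fst_deriv_snd_comm {f : ℝ → ℝ → ℝ}
    (hf : ContDiff ℝ (⊤ : ℕ∞) (Function.uncurry f)) (t x : ℝ) :
    deriv (fun s => deriv (f s) x) t = deriv (fun y => deriv (fun s => f s y) t) x := by
  have hd : Differentiable ℝ (fderiv ℝ (Function.uncurry f)) :=
    (hf.fderiv_right (m := (⊤ : ℕ∞)) (by simp)).differentiable (by simp)
  have h1 : HasDerivAt (fun s => fderiv ℝ (Function.uncurry f) (s, x) (0, 1))
      (fderiv ℝ (fderiv ℝ (Function.uncurry f)) (t, x) (1, 0) (0, 1)) t := by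
    simpa using (hd (t, x)).hasFDerivAt.hasDerivAt_prodMk_left.clm_apply
      (hasDerivAt_const t ((0 : ℝ), (1 : ℝ)))
  have h2 : HasDerivAt (fun y => fderiv ℝ (Function.uncurry f) (t, y) (1, 0))
      (fderiv ℝ (fderiv ℝ (Function.uncurry f)) (t, x) (0, 1) (1, 0)) x := by
    simpa using (hd (t, x)).hasFDerivAt.hasDerivAt_prodMk_right.clm_apply
      (hasDerivAt_const x ((1 : ℝ), (0 : ℝ)))
  have hsymm : IsSymmSndFDerivAt ℝ (Function.uncurry f) (t, x) :=
    hf.contDiffAt.isSymmSndFDerivAt (by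
      rw [minSmoothness_of_isRCLikeNormedField]
      exact WithTop.coe_le_coe.2 (le_top : (2 : ℕ∞) ≤ ⊤))
  simp only [(hasDerivAt_snd_of_contDiff hf _ _).deriv,
    (hasDerivAt_fst_of_contDiff hf _ _).deriv]
  rw [h1.deriv, h2.deriv, hsymm.eq]

/-- Smooth solutions `f` of the convection-diffusion equation `∂ₜ f + v ∂ₓ f = ∂ₓ² f`. -/
def IsSmoothConvectionDiffusionSolution (v f : ℝ → ℝ → ℝ) : Prop :=
  ContDiff ℝ (⊤ : ℕ∞) (Function.uncurry f) ∧
    ∀ t x, deriv (fun s => f s x) t + v t x * deriv (f t) x = deriv (deriv (f t)) x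

theorem differentiableAt_snd_of_contDiff {f : ℝ → ℝ → ℝ}
    (hf : ContDiff ℝ (⊤ : ℕ∞) (Function.uncurry f)) (t x : ℝ) : DifferentiableAt ℝ (f t) x :=
  (hasDerivAt_snd_of_contDiff hf t x).differentiableAt

theorem differentiableAt_fst_of_contDiff {f : ℝ → ℝ → ℝ}
    (hf : ContDiff ℝ (⊤ : ℕ∞) (Function.uncurry f)) (t x : ℝ) :
    DifferentiableAt ℝ (fun s => f s x) t :=
  (hasDerivAt_fst_of_contDiff hf t x).differentiableAt

namespace IsSmoothConvectionDiffusionSolution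

variable {v f : ℝ → ℝ → ℝ}

/-- The space derivative of a solution solves the linearization of the Burgers equation. -/
theorem deriv_fst_deriv_snd (hv : ContDiff ℝ (⊤ : ℕ∞) (Function.uncurry v))
    (hf : IsSmoothConvectionDiffusionSolution v f) (t x : ℝ) :
    deriv (fun s => deriv (f s) x) t = deriv (deriv (deriv (f t))) x
      - (deriv (v t) x * deriv (f t) x + v t x * deriv (deriv (f t)) x) := by
  have h1 := contDiff_deriv_snd hf.1
  have h2 := contDiff_deriv_snd h1
  have heq : (fun y => deriv (fun s => f s y) t)
      = fun y => deriv (deriv (f t)) y - v t y * deriv (f t) y := by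
    ext y
    linarith [hf.2 t y]
  rw [deriv_fst_deriv_snd_comm hf.1, heq]
  exact ((differentiableAt_snd_of_contDiff h2 t x).hasDerivAt.sub
    ((differentiableAt_snd_of_contDiff hv t x).hasDerivAt.mul
      (differentiableAt_snd_of_contDiff h1 t x).hasDerivAt)).deriv

theorem burgP (hf : IsSmoothConvectionDiffusionSolution v f)
    (hv : IsSmoothConvectionDiffusionSolution v v) :
    IsSmoothConvectionDiffusionSolution v (burgP v f) := by
  have hf1 := contDiff_deriv_snd hf.1
  have hf2 := contDiff_deriv_snd hf1
  have hv1 := contDiff_deriv_snd hv.1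
  refine ⟨hf1.sub ((contDiff_const.mul hv.1).mul hf.1), fun t x => ?_⟩
  have hx (y : ℝ) : HasDerivAt (_root_.burgP v f t) (deriv (deriv (f t)) y
      - (1 / 2 * deriv (v t) y * f t y + 1 / 2 * v t y * deriv (f t) y)) y :=
    (differentiableAt_snd_of_contDiff hf1 t y).hasDerivAt.sub
      (((differentiableAt_snd_of_contDiff hv.1 t y).hasDerivAt.const_mul _).mul
        (differentiableAt_snd_of_contDiff hf.1 t y).hasDerivAt)
  have hxx : HasDerivAt (deriv (_root_.burgP v f t)) (deriv (deriv (deriv (f t))) x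
      - ((1 / 2 * deriv (deriv (v t)) x * f t x + 1 / 2 * deriv (v t) x * deriv (f t) x)
        + (1 / 2 * deriv (v t) x * deriv (f t) x
          + 1 / 2 * v t x * deriv (deriv (f t)) x))) x := by
    rw [funext fun y => (hx y).deriv]
    have dv := (differentiableAt_snd_of_contDiff hv.1 t x).hasDerivAt
    have dv1 := (differentiableAt_snd_of_contDiff hv1 t x).hasDerivAt
    have df := (differentiableAt_snd_of_contDiff hf.1 t x).hasDerivAt
    have df1 := (differentiableAt_snd_of_contDiff hf1 t x).hasDerivAt
    have df2 := (differentiableAt_snd_of_contDiff hf2 t x).hasDerivAt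
    exact df2.sub (((dv1.const_mul _).mul df).add ((dv.const_mul _).mul df1))
  have ht : HasDerivAt (fun s => _root_.burgP v f s x) (deriv (fun s => deriv (f s) x) t
      - (1 / 2 * deriv (fun s => v s x) t * f t x
        + 1 / 2 * v t x * deriv (fun s => f s x) t)) t :=
    (differentiableAt_fst_of_contDiff hf1 t x).hasDerivAt.sub
      (((differentiableAt_fst_of_contDiff hv.1 t x).hasDerivAt.const_mul _).mul
        (differentiableAt_fst_of_contDiff hf.1 t x).hasDerivAt)
  rw [ht.deriv, (hx x).deriv, hxx.deriv, hf.deriv_fst_deriv_snd hv.1]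
  linear_combination (-(1 / 2) * f t x) * hv.2 t x - (1 / 2 * v t x) * hf.2 t x

theorem burgG (hf : IsSmoothConvectionDiffusionSolution v f)
    (hv : IsSmoothConvectionDiffusionSolution v v) :
    IsSmoothConvectionDiffusionSolution v (burgG v f) := by
  have hg := hf.burgP hv
  have hf1 := contDiff_deriv_snd hf.1
  have hg1 := contDiff_deriv_snd hg.1
  refine ⟨(contDiff_fst.mul hg.1).add ((contDiff_snd.div_const 2).mul hf.1), fun t x => ?_⟩
  have hx (y : ℝ) : HasDerivAt (_root_.burgG v f t) (t * deriv (_root_.burgP v f t) y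
      + (1 / 2 * f t y + y / 2 * deriv (f t) y)) y :=
    ((differentiableAt_snd_of_contDiff hg.1 t y).hasDerivAt.const_mul t).add
      (((hasDerivAt_id y).div_const 2).mul
        (differentiableAt_snd_of_contDiff hf.1 t y).hasDerivAt)
  have hxx : HasDerivAt (deriv (_root_.burgG v f t)) (t * deriv (deriv (_root_.burgP v f t)) x
      + (1 / 2 * deriv (f t) x
        + (1 / 2 * deriv (f t) x + x / 2 * deriv (deriv (f t)) x))) x := by
    rw [funext fun y => (hx y).deriv]
    exact ((differentiableAt_snd_of_contDiff hg1 t x).hasDerivAt.const_mul t).add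
      (((differentiableAt_snd_of_contDiff hf.1 t x).hasDerivAt.const_mul _).add
        (((hasDerivAt_id x).div_const 2).mul
          (differentiableAt_snd_of_contDiff hf1 t x).hasDerivAt))
  have ht : HasDerivAt (fun s => _root_.burgG v f s x)
      (1 * _root_.burgP v f t x + t * deriv (fun s => _root_.burgP v f s x) t
        + x / 2 * deriv (fun s => f s x) t) t :=
    ((hasDerivAt_id t).mul (differentiableAt_fst_of_contDiff hg.1 t x).hasDerivAt).add
      ((differentiableAt_fst_of_contDiff hf.1 t x).hasDerivAt.const_mul _)
  rw [ht.deriv, (hx x).deriv, hxx.deriv]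
  have hP : _root_.burgP v f t x = deriv (f t) x - 1 / 2 * v t x * f t x := rfl
  linear_combination hP + t * hg.2 t x + x / 2 * hf.2 t x

end IsSmoothConvectionDiffusionSolution

/-- If a smooth `v : ℝ² → ℝ` solves the Burgers equation `∂ₜ v + v ∂ₓ v = ∂ₓ² v`, then
for all `k, l ∈ ℕ` the function `η^{kl} := ∂ₓ(Ĝ^k P̂^l 1)` satisfies the linearized
Burgers equation `∂ₜ η + v ∂ₓ η + (∂ₓ v) η − ∂ₓ² η = 0`; i.e., each
`𝔔̂^{kl} = (D_x Ĝ^k P̂^l 1) ∂_v` is a generalized symmetry of the Burgers equation. -/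
theorem burgers_generalized_symmetries
    (v : ℝ → ℝ → ℝ)
    (hv : ContDiff ℝ (⊤ : ℕ∞) (Function.uncurry v))
    (hburg : ∀ t x, deriv (fun s => v s x) t + v t x * deriv (v t) x
        = deriv (deriv (v t)) x)
    (k l : ℕ)
    (η : ℝ → ℝ → ℝ)
    (hη : ∀ t x, η t x
        = deriv (((burgG v)^[k] ((burgP v)^[l] (fun _ _ => (1 : ℝ)))) t) x) :
    ∀ t x, deriv (fun s => η s x) t + v t x * deriv (η t) x
        + deriv (v t) x * η t x - deriv (deriv (η t)) x = 0 := by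
  have hv' : IsSmoothConvectionDiffusionSolution v v := ⟨hv, hburg⟩
  have hone : IsSmoothConvectionDiffusionSolution v fun _ _ => 1 :=
    ⟨contDiff_const, fun t x => by simp⟩
  have hP : IsSmoothConvectionDiffusionSolution v ((burgP v)^[l] fun _ _ => 1) :=
    Function.Iterate.rec _ hone (fun _ h => IsSmoothConvectionDiffusionSolution.burgP h hv') l
  have hG : IsSmoothConvectionDiffusionSolution v
      ((burgG v)^[k] ((burgP v)^[l] fun _ _ => 1)) :=
    Function.Iterate.rec _ hP (fun _ h => IsSmoothConvectionDiffusionSolution.burgG h hv') k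
  obtain rfl : η = fun t x => deriv (((burgG v)^[k] ((burgP v)^[l] fun _ _ => 1)) t) x :=
    funext₂ hη
  intro t x
  have h := hG.deriv_fst_deriv_snd hv t x
  linear_combination h
end

section
/- Let u : ℝ² → ℝ be a smooth function of the variables (t,x) that solves the heat equation ∂_t u = ∂_x² u and satisfies u(t,x) > 0 for all (t,x), and set v := −2·(∂_x u)/u. Then for all k, l ∈ ℕ one has Ĝ^k P̂^l 1 = (G^k P^l u)/u, where P̂ and Ĝ are built from v and P, G are the heat-equation operators. Consequently the characteristics of the generalized symmetries of the Burgers equation satisfy ∂_x(Ĝ^k P̂^l 1) = ∂_x((G^k P^l u)/u). -/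
theorem contDiff_heatP {f : ℝ → ℝ → ℝ} (hf : ∀ t, ContDiff ℝ (⊤ : ℕ∞) (f t)) (t : ℝ) :
    ContDiff ℝ (⊤ : ℕ∞) (heatP f t) :=
  (contDiff_infty_iff_deriv.1 (hf t)).2

theorem contDiff_heatG {f : ℝ → ℝ → ℝ} (hf : ∀ t, ContDiff ℝ (⊤ : ℕ∞) (f t)) (t : ℝ) :
    ContDiff ℝ (⊤ : ℕ∞) (heatG f t) :=
  (contDiff_const.mul (contDiff_heatP hf t)).add ((contDiff_id.div_const 2).mul (hf t))

/-- Division by `u` intertwines `P` with `P̂`. -/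
theorem burgP_div {u v f : ℝ → ℝ → ℝ} (hu : ∀ t, Differentiable ℝ (u t))
    (hu0 : ∀ t x, u t x ≠ 0) (hv : ∀ t x, v t x = -2 * deriv (u t) x / u t x)
    (hf : ∀ t, Differentiable ℝ (f t)) :
    burgP v (fun t x => f t x / u t x) = fun t x => heatP f t x / u t x := by
  funext t x
  have hd : deriv (fun y => f t y / u t y) x
      = (deriv (f t) x * u t x - f t x * deriv (u t) x) / u t x ^ 2 :=
    deriv_fun_div (hf t x) (hu t x) (hu0 t x)
  simp only [burgP, heatP, hd, hv]
  have := hu0 t x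
  field_simp
  ring

/-- Division by `u` intertwines `G` with `Ĝ`. -/
theorem burgG_div {u v f : ℝ → ℝ → ℝ} (hu : ∀ t, Differentiable ℝ (u t))
    (hu0 : ∀ t x, u t x ≠ 0) (hv : ∀ t x, v t x = -2 * deriv (u t) x / u t x)
    (hf : ∀ t, Differentiable ℝ (f t)) :
    burgG v (fun t x => f t x / u t x) = fun t x => heatG f t x / u t x := by
  funext t x
  simp only [burgG, burgP_div hu hu0 hv hf, heatG, heatP]
  ring

/-- If a smooth positive `u : ℝ² → ℝ` solves the heat equation `∂ₜ u = ∂ₓ² u`, and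
`v := −2 ∂ₓ u / u`, then `Ĝ^k P̂^l 1 = (G^k P^l u)/u` for all `k, l ∈ ℕ`, and hence
`∂ₓ(Ĝ^k P̂^l 1) = ∂ₓ((G^k P^l u)/u)`. -/
theorem burgers_symmetries_via_hopf_cole
    (u : ℝ → ℝ → ℝ)
    (hu : ContDiff ℝ (⊤ : ℕ∞) (Function.uncurry u))
    (hpos : ∀ t x, 0 < u t x)
    (hheat : ∀ t x, deriv (fun s => u s x) t = deriv (deriv (u t)) x)
    (v : ℝ → ℝ → ℝ)
    (hv : ∀ t x, v t x = -2 * deriv (u t) x / u t x)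
    (k l : ℕ) :
    (∀ t x, ((burgG v)^[k] ((burgP v)^[l] (fun _ _ => (1 : ℝ)))) t x
        = (heatG^[k] (heatP^[l] u)) t x / u t x)
      ∧ (∀ t x,
        deriv (((burgG v)^[k] ((burgP v)^[l] (fun _ _ => (1 : ℝ)))) t) x
          = deriv (fun y => (heatG^[k] (heatP^[l] u)) t y / u t y) x) := by
  have hsmooth : ∀ t, ContDiff ℝ (⊤ : ℕ∞) (u t) := fun t =>
    hu.comp (contDiff_const.prodMk contDiff_id)
  have hdiff {f : ℝ → ℝ → ℝ} (hf : ∀ t, ContDiff ℝ (⊤ : ℕ∞) (f t)) (t : ℝ) :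
      Differentiable ℝ (f t) := (hf t).differentiable (by simp)
  have hu0 : ∀ t x, u t x ≠ 0 := fun t x => (hpos t x).ne'
  have hP : (∀ t, ContDiff ℝ (⊤ : ℕ∞) ((heatP^[l] u) t)) ∧
      (burgP v)^[l] (fun _ _ => (1 : ℝ)) = fun t x => (heatP^[l] u) t x / u t x := by
    induction l with
    | zero => exact ⟨hsmooth, by funext t x; simp [hu0 t x]⟩
    | succ l ih =>
      simp only [Function.iterate_succ_apply']
      exact ⟨contDiff_heatP ih.1, by rw [ih.2, burgP_div (hdiff hsmooth) hu0 hv (hdiff ih.1)]⟩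
  have hG : (∀ t, ContDiff ℝ (⊤ : ℕ∞) ((heatG^[k] (heatP^[l] u)) t)) ∧
      (burgG v)^[k] ((burgP v)^[l] (fun _ _ => (1 : ℝ)))
        = fun t x => (heatG^[k] (heatP^[l] u)) t x / u t x := by
    induction k with
    | zero => exact hP
    | succ k ih =>
      simp only [Function.iterate_succ_apply']
      exact ⟨contDiff_heatG ih.1, by rw [ih.2, burgG_div (hdiff hsmooth) hu0 hv (hdiff ih.1)]⟩
  rw [hG.2]
  exact ⟨fun _ _ => rfl, fun _ _ => rfl⟩
end

section
/- Let n ≥ 1 and let α^1,…,α^n and β^1,…,β^n be smooth functions ℝ² → ℝ of the variables (t,x) such that α^n = 0, ∂_x β^n = 0 (β^n depends only on t), and for each i ∈ {1,…,n−1}: α^i = −(β^{i+1} + ∂_x α^{i+1}), 2·∂_x α^i = ∂_t α^{i+1} − ∂_x² α^{i+1}, and 2·∂_x β^i = ∂_t β^{i+1} − ∂_x² β^{i+1}. Then for every i ∈ {1,…,n} and every fixed t, the function x ↦ α^i(t,x) is a polynomial in x of degree at most n−i−1 and the function x ↦ β^i(t,x) is a polynomial in x of degree at most n−i; moreover, for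 each i ∈ {1,…,n−1} the coefficient of x^{n−i} in β^i(t,·) equals (d/dt)^{n−i} β^n(t) / (2^{n−i}·(n−i)!). -/
/-- The derivative of `∑ j < d, c j * x ^ j`, written as a sum over the same index set. -/
theorem hasDerivAt_sum_range_mul_pow (d : ℕ) (c : ℕ → ℝ) (x : ℝ) :
    HasDerivAt (fun y : ℝ => ∑ j ∈ Finset.range d, c j * y ^ j)
      (∑ j ∈ Finset.range d, (if j + 1 < d then (j + 1 : ℝ) * c (j + 1) else 0) * x ^ j) x := by
  have h : HasDerivAt (fun y : ℝ => ∑ j ∈ Finset.range d, c j * y ^ j)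
      (∑ j ∈ Finset.range d, c j * (j * x ^ (j - 1))) x :=
    HasDerivAt.fun_sum fun j _ => (hasDerivAt_pow j x).const_mul (c j)
  convert h using 1
  cases d with
  | zero => simp
  | succ d =>
    rw [Finset.sum_range_succ, Finset.sum_range_succ']
    simp only [lt_self_iff_false, if_false, zero_mul, add_zero, Nat.cast_zero, mul_zero,
      Nat.add_sub_cancel]
    refine Finset.sum_congr rfl fun j hj => ?_
    rw [if_pos (by simpa using hj)]
    push_cast
    ring

theorem deriv_sum_range_mul_pow (d : ℕ) (c : ℕ → ℝ) :
    deriv (fun y : ℝ => ∑ j ∈ Finset.range d, c j * y ^ j) = fun x =>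
      ∑ j ∈ Finset.range d, (if j + 1 < d then (j + 1 : ℝ) * c (j + 1) else 0) * x ^ j :=
  funext fun x => (hasDerivAt_sum_range_mul_pow d c x).deriv

/-- A differentiable function whose derivative is polynomial is itself polynomial. -/
theorem eq_sum_range_of_deriv_eq_sum_range {f : ℝ → ℝ} (hf : Differentiable ℝ f) (d : ℕ)
    (e : ℕ → ℝ) (h : ∀ x, deriv f x = ∑ j ∈ Finset.range d, e j * x ^ j) (x : ℝ) :
    f x = ∑ j ∈ Finset.range d, e j / (j + 1) * x ^ (j + 1) + f 0 := by
  have hF : ∀ y, HasDerivAt (fun y : ℝ => ∑ j ∈ Finset.range d, e j / (j + 1) * y ^ (j + 1))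
      (∑ j ∈ Finset.range d, e j * y ^ j) y := by
    intro y
    refine HasDerivAt.fun_sum fun j _ => ?_
    have : (j + 1 : ℝ) ≠ 0 := by positivity
    refine ((hasDerivAt_pow (j + 1) y).const_mul (e j / (j + 1))).congr_deriv ?_
    rw [Nat.add_sub_cancel]
    push_cast
    field_simp
  have hd : ∀ y, HasDerivAt
      (fun y => f y - ∑ j ∈ Finset.range d, e j / (j + 1) * y ^ (j + 1)) 0 y := by
    intro y
    have := (hf y).hasDerivAt.sub (hF y)
    rw [h y, sub_self] at this
    exact this
  have := is_const_of_deriv_eq_zero (fun y => (hd y).differentiableAt)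
    (fun y => (hd y).deriv) x 0
  simp only [ne_eq, Nat.add_eq_zero_iff, one_ne_zero, and_false, not_false_eq_true, zero_pow,
    mul_zero, Finset.sum_const_zero, sub_zero] at this
  linarith

open scoped ContDiff in
/-- If `g` is polynomial in `x` of degree at most `d` with coefficients smooth in `t`, then any
smooth solution `f` of `2 f_x = g_t - g_xx` is polynomial in `x` of degree at most `d + 1` with
coefficients smooth in `t`, and its leading coefficient is determined by that of `g`. -/
theorem exists_coeff_of_two_mul_deriv_eq {f g : ℝ → ℝ → ℝ}
    (hf : ContDiff ℝ ∞ (Function.uncurry f)) (d : ℕ) {c : ℕ → ℝ → ℝ}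
    (hc : ∀ j, ContDiff ℝ ∞ (c j))
    (hg : ∀ t x, g t x = ∑ j ∈ Finset.range (d + 1), c j t * x ^ j)
    (h : ∀ t x, 2 * deriv (f t) x = deriv (fun s => g s x) t - deriv (deriv (g t)) x) :
    ∃ b : ℕ → ℝ → ℝ, (∀ j, ContDiff ℝ ∞ (b j)) ∧
      (∀ t x, f t x = ∑ j ∈ Finset.range (d + 2), b j t * x ^ j) ∧
      ∀ t, b (d + 1) t = deriv (c d) t / (2 * (d + 1)) := by
  obtain ⟨e, he, hfe, hed⟩ : ∃ e : ℕ → ℝ → ℝ, (∀ j, ContDiff ℝ ∞ (e j)) ∧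
      (∀ t x, deriv (f t) x = ∑ j ∈ Finset.range (d + 1), e j t * x ^ j) ∧
      ∀ t, e d t = deriv (c d) t / 2 := by
    refine ⟨fun j t => (deriv (c j) t - if j + 1 < d + 1 then (j + 1 : ℝ) *
      (if j + 1 + 1 < d + 1 then ((j + 1 : ℕ) + 1 : ℝ) * c (j + 1 + 1) t else 0) else 0) / 2,
      fun j => ?_, fun t x => ?_, fun t => by simp⟩
    · have hdc : ContDiff ℝ ∞ (deriv (c j)) := (contDiff_infty_iff_deriv.1 (hc j)).2
      have hc2 := hc (j + 1 + 1)
      dsimp only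
      split_ifs <;> fun_prop
    · have ht : HasDerivAt (fun s => g s x)
          (∑ j ∈ Finset.range (d + 1), deriv (c j) t * x ^ j) t := by
        simp only [hg]
        exact HasDerivAt.fun_sum fun j _ =>
          ((hc j).differentiable (by simp) t).hasDerivAt.mul_const _
      have hx := h t x
      rw [ht.deriv, funext (hg t), deriv_sum_range_mul_pow, deriv_sum_range_mul_pow,
        ← Finset.sum_sub_distrib] at hx
      rw [← mul_right_inj' (two_ne_zero (α := ℝ)), hx, Finset.mul_sum]
      exact Finset.sum_congr rfl fun j _ => by ring
  have hft : ∀ t, Differentiable ℝ (f t) := fun t =>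
    (hf.comp (contDiff_const.prodMk contDiff_id : ContDiff ℝ ∞ fun x : ℝ => (t, x))).differentiable
      (by simp)
  have hf0 : ContDiff ℝ ∞ fun t => f t 0 :=
    hf.comp (contDiff_id.prodMk contDiff_const : ContDiff ℝ ∞ fun t : ℝ => (t, (0 : ℝ)))
  refine ⟨fun j => Nat.casesOn j (fun t => f t 0) fun k t => e k t / (k + 1), ?_, ?_, ?_⟩
  · rintro (_ | k)
    · exact hf0
    · exact (he k).div_const _
  · intro t x
    rw [Finset.sum_range_succ', pow_zero, mul_one]
    exact eq_sum_range_of_deriv_eq_sum_range (hft t) (d + 1) (fun j => e j t) (hfe t) x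
  · intro t
    simp only [hed, div_div]

open scoped ContDiff in
/-- Along a chain `2 (f k+1)_x = (f k)_t - (f k)_xx` started at a function of `t` alone, the
`k`-th member is polynomial in `x` of degree at most `k`, with explicit leading coefficient. -/
theorem exists_coeff_of_chain {N : ℕ} {f : ℕ → ℝ → ℝ → ℝ}
    (hf : ∀ k ≤ N, ContDiff ℝ ∞ (Function.uncurry (f k)))
    (h0 : ∀ t x, deriv (f 0 t) x = 0)
    (h : ∀ k < N, ∀ t x, 2 * deriv (f (k + 1) t) x
      = deriv (fun s => f k s x) t - deriv (deriv (f k t)) x) :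
    ∀ k ≤ N, ∃ b : ℕ → ℝ → ℝ, (∀ j, ContDiff ℝ ∞ (b j)) ∧
      (∀ t x, f k t x = ∑ j ∈ Finset.range (k + 1), b j t * x ^ j) ∧
      ∀ t, b k t = iteratedDeriv k (fun s => f 0 s 0) t / (2 ^ k * Nat.factorial k) := by
  intro k
  induction k with
  | zero =>
    intro hN
    refine ⟨fun _ t => f 0 t 0, fun _ => (hf 0 hN).comp
      (contDiff_id.prodMk contDiff_const : ContDiff ℝ ∞ fun t : ℝ => (t, (0 : ℝ))), ?_, by simp⟩
    intro t x
    have hd : Differentiable ℝ (f 0 t) := ((hf 0 hN).comp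
      (contDiff_const.prodMk contDiff_id : ContDiff ℝ ∞ fun x : ℝ => (t, x))).differentiable
        (by simp)
    simpa using is_const_of_deriv_eq_zero hd (h0 t) x 0
  | succ k ih =>
    intro hk
    obtain ⟨c, hc, hfc, hck⟩ := ih (by omega)
    obtain ⟨b, hb, hfb, hbk⟩ := exists_coeff_of_two_mul_deriv_eq (hf _ hk) k hc hfc (h k hk)
    refine ⟨b, hb, hfb, fun t => ?_⟩
    rw [hbk, funext hck, deriv_div_const, iteratedDeriv_succ, Nat.factorial_succ, div_div]
    push_cast
    ring_nf


/-- Solutions `α^1,…,α^n`, `β^1,…,β^n` of the system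
`α^i = −(β^{i+1} + α^{i+1}_x)`, `2 α^i_x = α^{i+1}_t − α^{i+1}_{xx}`,
`2 β^i_x = β^{i+1}_t − β^{i+1}_{xx}` (with `α^n = 0` and `β^n = β^n(t)`) arising in the
classification of generalized symmetries of the Burgers equation are polynomial in `x`:
for every fixed `t`, the function `x ↦ α^i(t,x)` is a polynomial of degree at most
`n−i−1` and `x ↦ β^i(t,x)` is a polynomial of degree at most `n−i`; moreover, for
`i ∈ {1,…,n−1}` the coefficient of `x^{n−i}` in `β^i(t,·)` equals
`(d/dt)^{n−i} β^n(t) / (2^{n−i} (n−i)!)`.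
(Degree at most `n−i−1` is expressed as being a sum `Σ_{j < n−i} a_j x^j`; in
particular for `i = n` this empty sum forces `α^n(t,·) = 0`.) -/
theorem burgers_classification_polynomial_coefficients
    (n : ℕ) (hn : 1 ≤ n)
    (α β : ℕ → ℝ → ℝ → ℝ)
    (hα : ∀ i ∈ Finset.Icc 1 n, ContDiff ℝ (⊤ : ℕ∞) (Function.uncurry (α i)))
    (hβ : ∀ i ∈ Finset.Icc 1 n, ContDiff ℝ (⊤ : ℕ∞) (Function.uncurry (β i)))
    (hαn : ∀ t x, α n t x = 0)
    (hβn : ∀ t x, deriv (β n t) x = 0)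
    (hrec1 : ∀ i ∈ Finset.Icc 1 (n - 1), ∀ t x,
      α i t x = -(β (i + 1) t x + deriv (α (i + 1) t) x))
    (hrec2 : ∀ i ∈ Finset.Icc 1 (n - 1), ∀ t x,
      2 * deriv (α i t) x
        = deriv (fun s => α (i + 1) s x) t - deriv (deriv (α (i + 1) t)) x)
    (hrec3 : ∀ i ∈ Finset.Icc 1 (n - 1), ∀ t x,
      2 * deriv (β i t) x
        = deriv (fun s => β (i + 1) s x) t - deriv (deriv (β (i + 1) t)) x) :
    ∀ i ∈ Finset.Icc 1 n, ∀ t : ℝ,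
      (∃ a : ℕ → ℝ, ∀ x, α i t x = ∑ j ∈ Finset.range (n - i), a j * x ^ j)
      ∧ (∃ b : ℕ → ℝ,
          (∀ x, β i t x = ∑ j ∈ Finset.range (n - i + 1), b j * x ^ j)
          ∧ (i < n → b (n - i)
              = iteratedDeriv (n - i) (fun s => β n s 0) t
                  / (2 ^ (n - i) * Nat.factorial (n - i)))) := by
  have hβ' : ∀ k ≤ n - 1, ∃ b : ℕ → ℝ → ℝ, (∀ j, ContDiff ℝ (⊤ : ℕ∞) (b j)) ∧
      (∀ t x, β (n - k) t x = ∑ j ∈ Finset.range (k + 1), b j t * x ^ j) ∧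
      ∀ t, b k t = iteratedDeriv k (fun s => β n s 0) t / (2 ^ k * Nat.factorial k) := by
    refine exists_coeff_of_chain (f := fun k => β (n - k))
      (fun k hk => hβ _ (Finset.mem_Icc.2 (by omega))) hβn fun k hk t x => ?_
    have := hrec3 (n - (k + 1)) (Finset.mem_Icc.2 (by omega)) t x
    rwa [show n - (k + 1) + 1 = n - k by omega] at this
  have hα' : ∀ k ≤ n - 1, ∀ t, ∃ a : ℕ → ℝ, ∀ x,
      α (n - k) t x = ∑ j ∈ Finset.range k, a j * x ^ j := by
    intro k
    induction k with
    | zero => exact fun _ t => ⟨0, fun x => by simp [hαn]⟩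
    | succ k ih =>
      intro hk t
      obtain ⟨a, ha⟩ := ih (by omega) t
      obtain ⟨b, -, hb, -⟩ := hβ' k (by omega)
      refine ⟨fun j => -(b j t + if j + 1 < k then (j + 1 : ℝ) * a (j + 1) else 0), fun x => ?_⟩
      have := hrec1 (n - (k + 1)) (Finset.mem_Icc.2 (by omega)) t x
      rw [show n - (k + 1) + 1 = n - k by omega, hb, funext ha, deriv_sum_range_mul_pow] at this
      rw [this]
      simp only [neg_mul, add_mul (b _ t), Finset.sum_neg_distrib, Finset.sum_add_distrib]
      rw [Finset.sum_range_succ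
        (fun j => (if j + 1 < k then (j + 1 : ℝ) * a (j + 1) else 0) * x ^ j),
        if_neg (by omega), zero_mul, add_zero]
  intro i hi t
  rw [Finset.mem_Icc] at hi
  have hi' : n - (n - i) = i := by omega
  obtain ⟨b, -, hb, hbk⟩ := hβ' (n - i) (by omega)
  have ha := hα' (n - i) (by omega) t
  rw [hi'] at hb ha
  exact ⟨ha, fun j => b j t, hb t, fun _ => hbk t⟩
end
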